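/- The density p_w(x) = (1/sqrt(2wπx)) e^{-x/(2w)} is a fixed point of the Directed Random Market operator: for almost every x > 0, p_w(x) = (1/2)∫₀^x p_w(x−u)(∫_u^∞ p_w(v)/v dv) du + (1/2)∫_x^∞ p_w(u)/u du. -/

import Mathlib

open MeasureTheory Real Set

noncomputable def T (p : ℝ → ℝ) (x : ℝ) : ℝ :=
  (1/2) * (∫ u in (0:ℝ)..x, p (x - u) * ∫ v in Ioi u, p v / v)
    + (1/2) * ∫ u in Ioi x, p u / u

/-- The density `p_w`; it vanishes on `(-∞, 0]` because `√` does and `1 / 0 = 0`. -/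
noncomputable def drmDensity (w y : ℝ) : ℝ :=
  (1 / Real.sqrt (2 * w * π * y)) * Real.exp (-y / (2 * w))

/-- The survival function of `drmDensity`. -/
noncomputable def drmTail (w u : ℝ) : ℝ := ∫ v in Ioi u, drmDensity w v

section

variable {w : ℝ}

lemma drmDensity_nonneg (w y : ℝ) : 0 ≤ drmDensity w y := by
  unfold drmDensity; positivity

lemma drmDensity_of_nonpos (hw : 0 < w) {y : ℝ} (hy : y ≤ 0) : drmDensity w y = 0 := by
  have : 2 * w * π * y ≤ 0 := mul_nonpos_of_nonneg_of_nonpos (by positivity) hy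
  simp [drmDensity, Real.sqrt_eq_zero_of_nonpos this]

lemma setIntegral_Ioi_zero_drmDensity (hw : 0 < w) : ∫ y in Ioi 0, drmDensity w y = 1 := by
  have hG := Real.integral_rpow_mul_exp_neg_mul_Ioi (a := 1 / 2) (r := 1 / (2 * w))
    (by norm_num) (by positivity)
  have hc : ∫ y in Ioi 0, drmDensity w y = ∫ y in Ioi (0 : ℝ),
      (1 / √(2 * w * π)) * (y ^ ((1 : ℝ) / 2 - 1) * exp (-(1 / (2 * w) * y))) := by
    refine setIntegral_congr_fun measurableSet_Ioi fun y (hy : 0 < y) => ?_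
    have h1 : y ^ ((1 : ℝ) / 2 - 1) = (√y)⁻¹ := by
      rw [Real.sqrt_eq_rpow, ← Real.rpow_neg hy.le]; norm_num
    simp only [drmDensity]
    rw [h1, Real.sqrt_mul (by positivity), show -y / (2 * w) = -(1 / (2 * w) * y) by ring]
    field_simp
  rw [hc, integral_const_mul, hG, Real.Gamma_one_half_eq, ← Real.sqrt_eq_rpow, one_div_one_div,
    Real.sqrt_mul (by positivity)]
  field_simp

lemma integrable_drmDensity (hw : 0 < w) : Integrable (drmDensity w) := by
  have h : IntegrableOn (drmDensity w) (Ioi 0) :=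
    .of_integral_ne_zero (by rw [setIntegral_Ioi_zero_drmDensity hw]; exact one_ne_zero)
  exact (integrableOn_iff_integrable_of_support_subset fun y hy => by
    by_contra hn
    exact hy (drmDensity_of_nonpos hw (not_lt.1 hn))).1 h

lemma drmTail_of_nonpos (hw : 0 < w) {u : ℝ} (hu : u ≤ 0) : drmTail w u = 1 := by
  rw [← setIntegral_Ioi_zero_drmDensity hw, drmTail]
  refine setIntegral_eq_of_subset_of_forall_sdiff_eq_zero measurableSet_Ioi
    (Ioi_subset_Ioi hu) fun y hy => drmDensity_of_nonpos hw (not_lt.1 hy.2)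

lemma antitone_drmTail (hw : 0 < w) : Antitone (drmTail w) := fun _ _ h =>
  setIntegral_mono_set (integrable_drmDensity hw).integrableOn
    (ae_of_all _ (drmDensity_nonneg w)) (Ioi_subset_Ioi h).eventuallyLE

lemma norm_drmTail_le_one (hw : 0 < w) (u : ℝ) : ‖drmTail w u‖ ≤ 1 := by
  have hnn : 0 ≤ drmTail w u :=
    setIntegral_nonneg measurableSet_Ioi fun y _ => drmDensity_nonneg w y
  rw [Real.norm_of_nonneg hnn, ← drmTail_of_nonpos hw (min_le_right u 0)]
  exact antitone_drmTail hw (min_le_left u 0)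

lemma integral_inv_sqrt_mul_sqrt {x : ℝ} (hx : 0 < x) :
    ∫ t in (0 : ℝ)..x, 1 / (√(x - t) * √t) = π := by
  have hcont : ContinuousOn (fun t => arcsin ((2 * t - x) / x)) (Icc 0 x) := by
    refine (Real.continuous_arcsin.comp ?_).continuousOn
    fun_prop
  have hderiv : ∀ t ∈ Ioo 0 x,
      HasDerivAt (fun t => arcsin ((2 * t - x) / x)) (1 / (√(x - t) * √t)) t := by
    rintro t ⟨h0, h1⟩
    have hne : (2 * t - x) / x ≠ -1 := by
      intro h; rw [div_eq_iff hx.ne'] at h; linarith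
    have hne' : (2 * t - x) / x ≠ 1 := by
      intro h; rw [div_eq_iff hx.ne'] at h; linarith
    have hin : HasDerivAt (fun t : ℝ => (2 * t - x) / x) (2 / x) t := by
      simpa using (((hasDerivAt_id t).const_mul 2).sub_const x).div_const x
    convert! (Real.hasDerivAt_arcsin hne hne').comp t hin using 1
    have hs : 1 - ((2 * t - x) / x) ^ 2 = (2 / x) ^ 2 * ((x - t) * t) := by
      field_simp; ring
    have ht : 0 < x - t := sub_pos.2 h1
    rw [hs, Real.sqrt_mul (by positivity), Real.sqrt_sq (by positivity), Real.sqrt_mul ht.le]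
    field_simp
  have hint := intervalIntegral.integrableOn_deriv_of_nonneg hcont hderiv
    fun t _ => by positivity
  rw [intervalIntegral.integral_eq_sub_of_hasDerivAt_of_le hx.le hcont hderiv
    ((intervalIntegrable_iff_integrableOn_Ioc_of_le hx.le).2 hint)]
  have h1 : (2 * x - x) / x = 1 := by field_simp; ring
  have h2 : (2 * 0 - x) / x = -1 := by field_simp; ring
  simp only [h1, h2, Real.arcsin_one, Real.arcsin_neg_one]
  ring

lemma intervalIntegral_drmDensity_mul_drmDensity (hw : 0 < w) {x : ℝ} (hx : 0 < x) :
    ∫ t in (0 : ℝ)..x, drmDensity w (x - t) * drmDensity w t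
      = exp (-(1 / (2 * w)) * x) / (2 * w) := by
  have h : ∀ t, drmDensity w (x - t) * drmDensity w t
      = exp (-(1 / (2 * w)) * x) / (2 * w * π) * (1 / (√(x - t) * √t)) := fun t => by
    have he : exp (-(1 / (2 * w)) * x) = exp (-(x - t) / (2 * w)) * exp (-t / (2 * w)) := by
      rw [← Real.exp_add]; congr 1; ring
    have hs := Real.mul_self_sqrt (show 0 ≤ 2 * w * π by positivity)
    have hi : 1 / (2 * w * π) = 1 / √(2 * w * π) * (1 / √(2 * w * π)) := by
      rw [div_mul_div_comm, hs, one_mul]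
    rw [div_eq_mul_one_div, hi, he, drmDensity, drmDensity,
      Real.sqrt_mul (by positivity) (x - t), Real.sqrt_mul (by positivity) t]
    generalize √(2 * w * π) = s
    simp only [one_div, mul_inv]
    ring
  simp_rw [h]
  rw [intervalIntegral.integral_const_mul, integral_inv_sqrt_mul_sqrt hx]
  field_simp

lemma integral_drmDensity_mul_eq_intervalIntegral (hw : 0 < w) {x : ℝ} (hx : 0 < x) (f : ℝ → ℝ) :
    ∫ t in Ioi 0, drmDensity w (x - t) * f t
      = ∫ t in (0 : ℝ)..x, drmDensity w (x - t) * f t := by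
  rw [intervalIntegral.integral_of_le hx.le]
  refine setIntegral_eq_of_subset_of_forall_sdiff_eq_zero measurableSet_Ioi
    Ioc_subset_Ioi_self fun t ht => ?_
  have : x - t ≤ 0 := by
    by_contra hn
    exact ht.2 ⟨ht.1, by linarith⟩
  rw [drmDensity_of_nonpos hw this, zero_mul]

lemma integral_drmDensity_mul_drmDensity (hw : 0 < w) {x : ℝ} (hx : 0 < x) :
    ∫ t, drmDensity w t * drmDensity w (x - t) = exp (-(1 / (2 * w)) * x) / (2 * w) := by
  rw [← intervalIntegral_drmDensity_mul_drmDensity hw hx,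
    ← integral_drmDensity_mul_eq_intervalIntegral hw hx,
    setIntegral_eq_integral_of_forall_compl_eq_zero]
  · simp_rw [mul_comm]
  · intro t ht
    rw [drmDensity_of_nonpos hw (not_lt.1 ht), mul_zero]

lemma integrable_drmDensity_mul_drmTail (hw : 0 < w) (x : ℝ) :
    Integrable fun u => drmDensity w (x - u) * drmTail w u :=
  ((integrable_drmDensity hw).comp_sub_left x).mul_bdd
    (antitone_drmTail hw).measurable.aestronglyMeasurable
    (ae_of_all _ (norm_drmTail_le_one hw))

lemma setIntegral_Ioi_drmDensity_sub (w x t : ℝ) :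
    ∫ y in Ioi x, drmDensity w (y - t) = drmTail w (x - t) := by
  have h := (measurePreserving_sub_right volume t).setIntegral_preimage_emb
    (MeasurableEquiv.subRight t).measurableEmbedding (drmDensity w) (Ioi (x - t))
  simpa [drmTail] using h

lemma setIntegral_Iic_drmDensity_sub (w x : ℝ) :
    ∫ u in Iic 0, drmDensity w (x - u) = drmTail w x := by
  have h := (volume.measurePreserving_sub_left x).setIntegral_preimage_emb
    (MeasurableEquiv.subLeft x).measurableEmbedding (drmDensity w) (Ici x)
  rw [integral_Ici_eq_integral_Ioi] at h
  simpa [drmTail] using h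

/-- Both sides are the probability that the sum of two independent variables with density
`drmDensity w` exceeds `x`. -/
lemma intervalIntegral_drmDensity_mul_drmTail_add (hw : 0 < w) {x : ℝ} (hx : 0 < x) :
    (∫ u in (0 : ℝ)..x, drmDensity w (x - u) * drmTail w u) + drmTail w x
      = exp (-(1 / (2 * w)) * x) := by
  have hi := integrable_drmDensity hw
  have hswap : ∫ y in Ioi x, ∫ t, drmDensity w t * drmDensity w (y - t)
      = ∫ t, ∫ y in Ioi x, drmDensity w t * drmDensity w (y - t) := by
    have h := (hi.convolution_integrand (.mul ℝ ℝ) hi).integrableOn (s := Ioi x ×ˢ univ)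
    rw [IntegrableOn, ← Measure.prod_restrict, Measure.restrict_univ] at h
    exact integral_integral_swap h
  have hl : ∫ y in Ioi x, ∫ t, drmDensity w t * drmDensity w (y - t)
      = exp (-(1 / (2 * w)) * x) := by
    rw [setIntegral_congr_fun measurableSet_Ioi fun y hy =>
      integral_drmDensity_mul_drmDensity hw (hx.trans hy), integral_div,
      integral_exp_mul_Ioi (by simpa using hw)]
    field_simp
  have hr : ∫ t, ∫ y in Ioi x, drmDensity w t * drmDensity w (y - t)
      = ∫ u, drmDensity w (x - u) * drmTail w u := by
    simp_rw [integral_const_mul, setIntegral_Ioi_drmDensity_sub]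
    rw [← integral_sub_left_eq_self _ volume x]
    simp
  have hI := integrable_drmDensity_mul_drmTail hw x
  rw [← hl, hswap, hr, ← integral_drmDensity_mul_eq_intervalIntegral hw hx,
    ← setIntegral_Iic_drmDensity_sub, add_comm,
    ← intervalIntegral.integral_Iic_add_Ioi (b := 0) hI.integrableOn hI.integrableOn]
  congr 1
  refine setIntegral_congr_fun measurableSet_Iic fun u hu => ?_
  simp [drmTail_of_nonpos hw hu]

lemma hasDerivAt_drmDensity (hw : 0 < w) {v : ℝ} (hv : 0 < v) :
    HasDerivAt (fun y => -2 * drmDensity w y)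
      (drmDensity w v / v + drmDensity w v / w) v := by
  have hs : HasDerivAt (fun y => √(2 * w * π * y)) (2 * w * π / (2 * √(2 * w * π * v))) v := by
    simpa using ((hasDerivAt_id v).const_mul (2 * w * π)).sqrt (by simp [hw.ne', hv.ne', pi_ne_zero])
  have he : HasDerivAt (fun y => exp (-y / (2 * w)))
      (exp (-v / (2 * w)) * (-1 / (2 * w))) v :=
    ((hasDerivAt_id v).neg.div_const _).exp
  have hp : 0 < √(2 * w * π * v) := by positivity
  unfold drmDensity
  convert! ((hs.inv hp.ne').mul he).const_mul (-2) using 1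
  · ext; simp
  · rw [Pi.inv_apply]
    have hsq := Real.sq_sqrt (show 0 ≤ 2 * w * π * v by positivity)
    set s := √(2 * w * π * v)
    have : π = s ^ 2 / (2 * w * v) := by rw [hsq]; field_simp
    rw [this]
    field_simp
    ring

lemma tendsto_drmDensity_atTop (hw : 0 < w) :
    Filter.Tendsto (drmDensity w) Filter.atTop (nhds 0) := by
  have h1 : Filter.Tendsto (fun y => 1 / √(2 * w * π * y)) Filter.atTop (nhds 0) := by
    simp_rw [one_div]
    exact (Real.tendsto_sqrt_atTop.comp
      (Filter.tendsto_id.const_mul_atTop (by positivity))).inv_tendsto_atTop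
  have h2 : Filter.Tendsto (fun y => exp (-y / (2 * w))) Filter.atTop (nhds 0) := by
    refine Real.tendsto_exp_atBot.comp ?_
    exact Filter.tendsto_neg_atTop_atBot.atBot_div_const (by positivity)
  have h := h1.mul h2
  rwa [mul_zero] at h

lemma setIntegral_drmDensity_div (hw : 0 < w) {u : ℝ} (hu : 0 < u) :
    ∫ v in Ioi u, drmDensity w v / v = 2 * drmDensity w u - drmTail w u / w := by
  have hd : ∀ v ∈ Ici u, HasDerivAt (fun y => -2 * drmDensity w y)
      (drmDensity w v / v + drmDensity w v / w) v :=
    fun v hv => hasDerivAt_drmDensity hw (hu.trans_le hv)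
  have hnn : ∀ v ∈ Ioi u, 0 ≤ drmDensity w v / v + drmDensity w v / w := fun v hv => by
    have := drmDensity_nonneg w v
    have := hu.trans hv
    positivity
  have ht : Filter.Tendsto (fun y => -2 * drmDensity w y) Filter.atTop (nhds 0) := by
    simpa using (tendsto_drmDensity_atTop hw).const_mul (-2)
  have hsum := integrableOn_Ioi_deriv_of_nonneg' hd hnn ht
  have hi : IntegrableOn (fun v => drmDensity w v / w) (Ioi u) :=
    ((integrable_drmDensity hw).div_const w).integrableOn
  have hsub : ∀ v, drmDensity w v / v
      = (drmDensity w v / v + drmDensity w v / w) - drmDensity w v / w := fun v => by ring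
  rw [setIntegral_congr_fun measurableSet_Ioi fun v _ => hsub v, integral_sub hsum hi,
    integral_Ioi_of_hasDerivAt_of_tendsto' hd hsum ht, integral_div, drmTail]
  ring

lemma T_drmDensity (hw : 0 < w) {x : ℝ} (hx : 0 < x) :
    T (drmDensity w) x = drmDensity w x := by
  have hpp := intervalIntegral_drmDensity_mul_drmDensity hw hx
  have hpt := intervalIntegral_drmDensity_mul_drmTail_add hw hx
  have hipp : IntervalIntegrable (fun t => drmDensity w (x - t) * drmDensity w t) volume 0 x :=
    intervalIntegral.intervalIntegrable_of_integral_ne_zero (by rw [hpp]; positivity)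
  have hipt : IntervalIntegrable (fun t => drmDensity w (x - t) * drmTail w t) volume 0 x :=
    (integrable_drmDensity_mul_drmTail hw x).intervalIntegrable
  have hconv : ∫ u in (0 : ℝ)..x, drmDensity w (x - u) * ∫ v in Ioi u, drmDensity w v / v
      = ∫ u in (0 : ℝ)..x, (2 * (drmDensity w (x - u) * drmDensity w u)
          - 1 / w * (drmDensity w (x - u) * drmTail w u)) := by
    rw [intervalIntegral.integral_of_le hx.le, intervalIntegral.integral_of_le hx.le]
    refine setIntegral_congr_fun measurableSet_Ioc fun u hu => ?_
    simp only [setIntegral_drmDensity_div hw hu.1]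
    ring
  rw [T, hconv, intervalIntegral.integral_sub (hipp.const_mul 2) (hipt.const_mul (1 / w)),
    intervalIntegral.integral_const_mul, intervalIntegral.integral_const_mul, hpp,
    eq_sub_of_add_eq hpt, setIntegral_drmDensity_div hw hx]
  field_simp
  ring

end

theorem drm_density_fixed_point (w : ℝ) (hw : 0 < w) :
    ∀ᵐ x ∂(volume.restrict (Ioi (0:ℝ))),
      (1 / Real.sqrt (2 * w * π * x)) * Real.exp (-x / (2 * w))
        = T (fun y => (1 / Real.sqrt (2 * w * π * y)) * Real.exp (-y / (2 * w))) x := by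
  filter_upwards [ae_restrict_mem measurableSet_Ioi] with x hx
  exact (T_drmDensity hw hx).symm
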